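/- Let p and q be probability measures on ℝ^D, each with finite first moment, and let t ∈ (0,1). Then for every x ∈ ℝ^D, the gradient of the log-density ratio of their Gaussian-smoothed marginals satisfies ∇_x log(q_t(x)/p_t(x)) = (t/(1−t)²)·(m_t^q(x) − m_t^p(x)), where m_t^p and m_t^q are the respective posterior means. (The guidance field identity underlying Equation (7).) -/

import Mathlib

open MeasureTheory Real Filter Topology

/-- The Gaussian kernel `G_t(x, y) = exp(−‖x − t·y‖²/(2(1−t)²))`. -/
noncomputable def gaussKernel {D : ℕ} (t : ℝ) (x y : EuclideanSpace ℝ (Fin D)) : ℝ :=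
  Real.exp (-‖x - t • y‖ ^ 2 / (2 * (1 - t) ^ 2))

/-- The posterior mean `m_t^p(x) = (∫ y·G_t(x,y) dp(y)) / (∫ G_t(x,y) dp(y))`. -/
noncomputable def postMean {D : ℕ} (p : Measure (EuclideanSpace ℝ (Fin D))) (t : ℝ)
    (x : EuclideanSpace ℝ (Fin D)) : EuclideanSpace ℝ (Fin D) :=
  (∫ y, gaussKernel t x y ∂p)⁻¹ • ∫ y, gaussKernel t x y • y ∂p

/-- The Gaussian-smoothed marginal density
`p_t(x) = (2π(1−t)²)^{−D/2} ∫ G_t(x,y) dp(y)`. -/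
noncomputable def marginalDensity {D : ℕ} (p : Measure (EuclideanSpace ℝ (Fin D))) (t : ℝ)
    (x : EuclideanSpace ℝ (Fin D)) : ℝ :=
  (2 * Real.pi * (1 - t) ^ 2) ^ (-(D : ℝ) / 2) * ∫ y, gaussKernel t x y ∂p

theorem gaussKernel_pos {D : ℕ} (t : ℝ) (x y : EuclideanSpace ℝ (Fin D)) :
    0 < gaussKernel t x y :=
  Real.exp_pos _

theorem gaussKernel_le_one {D : ℕ} (t : ℝ) (x y : EuclideanSpace ℝ (Fin D)) :
    gaussKernel t x y ≤ 1 := by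
  refine Real.exp_le_one_iff.mpr (div_nonpos_of_nonpos_of_nonneg ?_ (by positivity))
  simp

theorem continuous_gaussKernel {D : ℕ} (t : ℝ) (x : EuclideanSpace ℝ (Fin D)) :
    Continuous (gaussKernel t x) := by
  unfold gaussKernel
  fun_prop

theorem hasGradientAt_gaussKernel {D : ℕ} (t : ℝ) (x y : EuclideanSpace ℝ (Fin D)) :
    HasGradientAt (fun x' => gaussKernel t x' y)
      (((1 - t) ^ 2)⁻¹ • gaussKernel t x y • (t • y - x)) x := by
  rw [hasGradientAt_iff_hasFDerivAt]
  have h : HasFDerivAt (fun x' => -‖x' - t • y‖ ^ 2 * (2 * (1 - t) ^ 2)⁻¹) _ x :=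
    (((hasFDerivAt_id x).sub_const (t • y)).norm_sq.neg).mul_const _
  simp only [gaussKernel, div_eq_mul_inv]
  refine h.exp.congr_fderiv ?_
  ext z
  simp
  ring

section Integral

variable {D : ℕ} {p : Measure (EuclideanSpace ℝ (Fin D))}

theorem integrable_gaussKernel_smul (hp : Integrable (fun y => ‖y‖) p) (t : ℝ)
    (x : EuclideanSpace ℝ (Fin D)) : Integrable (fun y => gaussKernel t x y • y) p := by
  refine hp.mono' ((continuous_gaussKernel t x).smul continuous_id).aestronglyMeasurable
    (ae_of_all _ fun y => ?_)
  rw [norm_smul, Real.norm_of_nonneg (gaussKernel_pos t x y).le]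
  exact mul_le_of_le_one_left (norm_nonneg y) (gaussKernel_le_one t x y)

variable [IsProbabilityMeasure p]

theorem integrable_gaussKernel (t : ℝ) (x : EuclideanSpace ℝ (Fin D)) :
    Integrable (gaussKernel t x) p := by
  refine (integrable_const (1 : ℝ)).mono' (continuous_gaussKernel t x).aestronglyMeasurable
    (ae_of_all _ fun y => ?_)
  rw [Real.norm_of_nonneg (gaussKernel_pos t x y).le]
  exact gaussKernel_le_one t x y

theorem integral_gaussKernel_pos (t : ℝ) (x : EuclideanSpace ℝ (Fin D)) :
    0 < ∫ y, gaussKernel t x y ∂p :=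
  integral_exp_pos (integrable_gaussKernel t x)

theorem hasGradientAt_integral_gaussKernel (hp : Integrable (fun y => ‖y‖) p) (t : ℝ)
    (x : EuclideanSpace ℝ (Fin D)) :
    HasGradientAt (fun x' => ∫ y, gaussKernel t x' y ∂p)
      (((1 - t) ^ 2)⁻¹ • (t • ∫ y, gaussKernel t x y • y ∂p -
        (∫ y, gaussKernel t x y ∂p) • x)) x := by
  let v : EuclideanSpace ℝ (Fin D) → EuclideanSpace ℝ (Fin D) → EuclideanSpace ℝ (Fin D) :=
    fun x' y => ((1 - t) ^ 2)⁻¹ • gaussKernel t x' y • (t • y - x')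
  let F' : EuclideanSpace ℝ (Fin D) → EuclideanSpace ℝ (Fin D) →
      StrongDual ℝ (EuclideanSpace ℝ (Fin D)) :=
    fun x' y => InnerProductSpace.toDual ℝ _ (v x' y)
  let bound : EuclideanSpace ℝ (Fin D) → ℝ :=
    fun y => ((1 - t) ^ 2)⁻¹ * (|t| * ‖y‖ + (‖x‖ + 1))
  have hv_cont : Continuous (v x) := by
    have := continuous_gaussKernel t x
    fun_prop
  have hF'_meas : AEStronglyMeasurable (F' x) p :=
    ((InnerProductSpace.toDual ℝ _).continuous.comp hv_cont).aestronglyMeasurable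
  have hbound : ∀ y, ∀ x' ∈ Metric.ball x 1, ‖F' x' y‖ ≤ bound y := by
    intro y x' hx'
    have hx'_norm : ‖x'‖ ≤ ‖x‖ + 1 := by
      have := norm_le_norm_add_norm_sub x x'
      rw [mem_ball_iff_norm] at hx'
      linarith [norm_sub_rev x x']
    have hsub : ‖t • y - x'‖ ≤ |t| * ‖y‖ + (‖x‖ + 1) := by
      refine (norm_sub_le _ _).trans ?_
      rw [norm_smul, Real.norm_eq_abs]
      gcongr
    simp only [F', v, bound, LinearIsometryEquiv.norm_map]
    rw [norm_smul, norm_smul, Real.norm_of_nonneg (gaussKernel_pos t x' y).le,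
      Real.norm_of_nonneg (by positivity)]
    gcongr
    exact (mul_le_of_le_one_left (norm_nonneg _) (gaussKernel_le_one t x' y)).trans hsub
  have hbound_int : Integrable bound p :=
    ((hp.const_mul |t|).add (integrable_const (‖x‖ + 1))).const_mul _
  have hF'_int : Integrable (F' x) p :=
    hbound_int.mono' hF'_meas (ae_of_all _ fun y => hbound y x (Metric.mem_ball_self one_pos))
  have hderiv : HasFDerivAt (fun x' => ∫ y, gaussKernel t x' y ∂p) (∫ y, F' x y ∂p) x :=
    hasFDerivAt_integral_of_dominated_of_fderiv_le (Metric.ball_mem_nhds x one_pos)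
      (Eventually.of_forall fun x' => (continuous_gaussKernel t x').aestronglyMeasurable)
      (integrable_gaussKernel t x) hF'_meas (ae_of_all _ hbound) hbound_int
      (ae_of_all _ fun y x' _ => (hasGradientAt_gaussKernel t x' y).hasFDerivAt)
  have hG_smul := integrable_gaussKernel_smul hp t x
  have hG_smul' : Integrable (fun y => t • gaussKernel t x y • y) p := hG_smul.smul t
  have hG_const := (integrable_gaussKernel (p := p) t x).smul_const x
  have hv_eq : v x = fun y => ((1 - t) ^ 2)⁻¹ •
      (t • gaussKernel t x y • y - gaussKernel t x y • x) := by
    ext1 y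
    simp only [v, smul_sub, smul_comm t]
  have hv_int : Integrable (v x) p := by
    rw [hv_eq]
    exact (hG_smul'.sub hG_const).smul ((1 - t) ^ 2)⁻¹
  have hv_integral : ∫ y, v x y ∂p = ((1 - t) ^ 2)⁻¹ •
      (t • ∫ y, gaussKernel t x y • y ∂p - (∫ y, gaussKernel t x y ∂p) • x) := by
    rw [hv_eq, integral_smul, integral_sub hG_smul' hG_const, integral_smul,
      integral_smul_const]
  rw [hasGradientAt_iff_hasFDerivAt, ← hv_integral]
  refine hderiv.congr_fderiv (ContinuousLinearMap.ext fun z => ?_)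
  rw [ContinuousLinearMap.integral_apply hF'_int]
  simp only [F', InnerProductSpace.toDual_apply_apply]
  simp only [real_inner_comm z]
  exact integral_inner hv_int z

theorem hasGradientAt_log_integral_gaussKernel (hp : Integrable (fun y => ‖y‖) p) (t : ℝ)
    (x : EuclideanSpace ℝ (Fin D)) :
    HasGradientAt (fun x' => Real.log (∫ y, gaussKernel t x' y ∂p))
      (((1 - t) ^ 2)⁻¹ • (t • postMean p t x - x)) x := by
  have hZ := (integral_gaussKernel_pos (p := p) t x).ne'
  rw [hasGradientAt_iff_hasFDerivAt]
  refine ((hasGradientAt_integral_gaussKernel hp t x).hasFDerivAt.log hZ).congr_fderiv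
    (ContinuousLinearMap.ext fun z => ?_)
  simp only [postMean, InnerProductSpace.toDual_apply_apply, inner_smul_left, inner_sub_left,
    smul_apply, smul_eq_mul, conj_trivial]
  field_simp

end Integral

theorem marginalDensity_div_marginalDensity {D : ℕ} (p q : Measure (EuclideanSpace ℝ (Fin D)))
    {t : ℝ} (ht : t ≠ 1) (x : EuclideanSpace ℝ (Fin D)) :
    marginalDensity q t x / marginalDensity p t x =
      (∫ y, gaussKernel t x y ∂q) / ∫ y, gaussKernel t x y ∂p := by
  have h : 0 < 2 * Real.pi * (1 - t) ^ 2 := by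
    have := sub_ne_zero.mpr ht.symm
    positivity
  exact mul_div_mul_left _ _ (Real.rpow_pos_of_pos h _).ne'

/-- The guidance field identity underlying Equation (7):
`∇_x log(q_t(x)/p_t(x)) = (t/(1−t)²)·(m_t^q(x) − m_t^p(x))`. -/
theorem gradient_log_ratio_eq_postMean_diff
    (D : ℕ) (p q : Measure (EuclideanSpace ℝ (Fin D)))
    [IsProbabilityMeasure p] [IsProbabilityMeasure q]
    (hp : Integrable (fun y => ‖y‖) p) (hq : Integrable (fun y => ‖y‖) q)
    (t : ℝ) (ht : t ∈ Set.Ioo (0 : ℝ) 1)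
    (x : EuclideanSpace ℝ (Fin D)) :
    gradient (fun x' => Real.log (marginalDensity q t x' / marginalDensity p t x')) x
      = (t / (1 - t) ^ 2) • (postMean q t x - postMean p t x) := by
  have h := (hasGradientAt_log_integral_gaussKernel hq t x).hasFDerivAt.sub
    (hasGradientAt_log_integral_gaussKernel hp t x).hasFDerivAt
  rw [← map_sub] at h
  have hlog : (fun x' => Real.log (marginalDensity q t x' / marginalDensity p t x')) =
      (fun x' => Real.log (∫ y, gaussKernel t x' y ∂q)) -
        fun x' => Real.log (∫ y, gaussKernel t x' y ∂p) := by
    ext x'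
    rw [marginalDensity_div_marginalDensity p q ht.2.ne, Real.log_div
      (integral_gaussKernel_pos t x').ne' (integral_gaussKernel_pos t x').ne', Pi.sub_apply]
  rw [hlog, (hasGradientAt_iff_hasFDerivAt.mpr h).gradient, ← smul_sub, sub_sub_sub_cancel_right,
    ← smul_sub, smul_smul, div_eq_inv_mul]
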